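/- Let V = {0,1,...,n} with n = 2ν+1 odd (so |V| = 2ν+2 is even, ν ≥ 1), and let (i_1,...,i_{ν+1}) and (j_1,...,j_ν) be two sequences that together enumerate {1,...,n} without repetition. Define the edge sets A = {(i_p, j_p) : p = 1,...,ν} ∪ {(i_{ν+1}, 0)} and A' = {(i_1, i_2)} ∪ {(i_p, j_{p−2}) : p = 3,...,ν+1} ∪ {(j_ν, 0)}, and let A'' be obtained from A' by exchanging the roles of i_1 and j_1 (i.e. A'' = {(j_1, i_2)} ∪ {(i_1, j_1') ...} as in exchanging the vertices at position 1 of the two rows). Then A ∪ A' and A ∪ A'' are Hamiltonian cycles on V, and with suitable orientations they form a feasible pair of pickup and delivery tours for the DTSPMS with 2 rows of capacity ν+1. -/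

import Mathlib

open Finset

/-- A tour on `V = {0,1,...,n}` (`0` is the depot) is encoded by a permutation `σ` of
`Fin n`: the item visited at position `p+1` is `σ p` (items `1,...,n` are encoded as
`Fin n` and embedded in `V = Fin (n+1)` via `Fin.succ`). `tourSeq σ q` is the vertex
visited at position `q` of the cycle (position `0` is the depot). -/
def tourSeq {n : ℕ} (σ : Equiv.Perm (Fin n)) (q : Fin (n + 1)) : Fin (n + 1) :=
  if h : q = 0 then 0 else (σ (q.pred h)).succ

/-- Value of a tour: the sum of `d` over its `n+1` consecutive ordered pairs. -/
def tourValue {n : ℕ} (d : Fin (n + 1) → Fin (n + 1) → ℚ) (σ : Equiv.Perm (Fin n)) : ℚ :=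
  ∑ q : Fin (n + 1), d (tourSeq σ q) (tourSeq σ (q + 1))

/-- The reverse tour `T⁻`. -/
def revTour {n : ℕ} (σ : Equiv.Perm (Fin n)) : Equiv.Perm (Fin n) :=
  Fin.revPerm.trans σ

/-- Tour `σ` visits item `i` before item `j`. -/
def visitsBefore {n : ℕ} (σ : Equiv.Perm (Fin n)) (i j : Fin n) : Prop :=
  σ.symm i < σ.symm j

/-- A loading plan with `k` rows, each of capacity `c`: every fiber has size at most `c`. -/
def IsLoadingPlan {n : ℕ} (k c : ℕ) (f : Fin n → Fin k) : Prop :=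
  ∀ r : Fin k, (Finset.univ.filter fun i => f i = r).card ≤ c

/-- The pair of tours `(σP, σD)` is consistent with the loading plan `f`: items loaded in
the same row are visited in opposite orders by the two tours. -/
def FeasibleFor {n k : ℕ} (f : Fin n → Fin k) (σP σD : Equiv.Perm (Fin n)) : Prop :=
  ∀ i j : Fin n, i ≠ j → f i = f j → (visitsBefore σP i j ↔ visitsBefore σD j i)

/-- `(σP, σD)` is a feasible pair of pickup and delivery tours for parameters `(k, c)`. -/
def FeasiblePair {n : ℕ} (k c : ℕ) (σP σD : Equiv.Perm (Fin n)) : Prop :=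
  ∃ f : Fin n → Fin k, IsLoadingPlan k c f ∧ FeasibleFor f σP σD

/-- `d_Σ(i,j) = d_P(i,j) + d_D(j,i)`. -/
def dSigma {n : ℕ} (dP dD : Fin (n + 1) → Fin (n + 1) → ℚ) (i j : Fin (n + 1)) : ℚ :=
  dP i j + dD j i

/-- The set of values of tours under distance `d`. -/
def tourValues (n : ℕ) (d : Fin (n + 1) → Fin (n + 1) → ℚ) : Set ℚ :=
  {v | ∃ σ : Equiv.Perm (Fin n), v = tourValue d σ}

/-- The set of values of feasible pairs of pickup and delivery tours. -/
def feasibleValues (n k c : ℕ) (dP dD : Fin (n + 1) → Fin (n + 1) → ℚ) : Set ℚ :=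
  {v | ∃ σP σD : Equiv.Perm (Fin n), FeasiblePair k c σP σD ∧
        v = tourValue dP σP + tourValue dD σD}

/-- The set of (undirected) edges of a tour. -/
def tourEdges {n : ℕ} (σ : Equiv.Perm (Fin n)) : Set (Sym2 (Fin (n + 1))) :=
  {e | ∃ q : Fin (n + 1), e = s(tourSeq σ q, tourSeq σ (q + 1))}

/-- The edge set `A = {(i_p, j_p) : p = 1,...,ν} ∪ {(i_{ν+1}, 0)}` associated with a
balanced 2-row loading plan with rows `(i_1,...,i_{ν+1})` and `(j_1,...,j_ν)`
(items of `{1,...,n}` are encoded as `Fin n` and embedded in `V = Fin (n+1)`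
via `Fin.succ`). -/
def setA (ν : ℕ) (I : Fin (ν + 1) → Fin (2 * ν + 1)) (J : Fin ν → Fin (2 * ν + 1)) :
    Set (Sym2 (Fin (2 * ν + 1 + 1))) :=
  {e | (∃ p : Fin ν, e = s((I p.castSucc).succ, (J p).succ)) ∨
       e = s((I (Fin.last ν)).succ, 0)}

/-- The edge set `A' = {(i_1, i_2)} ∪ {(i_p, j_{p−2}) : p = 3,...,ν+1} ∪ {(j_ν, 0)}`. -/
def setA' (ν : ℕ) (hν : 1 ≤ ν)
    (I : Fin (ν + 1) → Fin (2 * ν + 1)) (J : Fin ν → Fin (2 * ν + 1)) :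
    Set (Sym2 (Fin (2 * ν + 1 + 1))) :=
  {e | e = s((I ⟨0, by omega⟩).succ, (I ⟨1, by omega⟩).succ) ∨
       (∃ q : Fin (ν - 1), e = s((I ⟨q.val + 2, by have := q.isLt; omega⟩).succ,
          (J ⟨q.val, by have := q.isLt; omega⟩).succ)) ∨
       e = s((J ⟨ν - 1, by omega⟩).succ, 0)}

/-- Row 1 after exchanging the vertices at position 1 of rows 1 and 2. -/
def rowSwap1 (ν : ℕ) (hν : 1 ≤ ν)
    (I : Fin (ν + 1) → Fin (2 * ν + 1)) (J : Fin ν → Fin (2 * ν + 1)) :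
    Fin (ν + 1) → Fin (2 * ν + 1) :=
  fun p => if p = ⟨0, by omega⟩ then J ⟨0, by omega⟩ else I p

/-- Row 2 after exchanging the vertices at position 1 of rows 1 and 2. -/
def rowSwap2 (ν : ℕ) (hν : 1 ≤ ν)
    (I : Fin (ν + 1) → Fin (2 * ν + 1)) (J : Fin ν → Fin (2 * ν + 1)) :
    Fin ν → Fin (2 * ν + 1) :=
  fun q => if q = ⟨0, by omega⟩ then I ⟨0, by omega⟩ else J q

def posV (ν : ℕ) : Fin (ν + 1) ⊕ Fin ν → ℕ
  | Sum.inl p => if (ν - p.val) % 2 = 0 then ν - p.val else ν + p.val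
  | Sum.inr p => if (ν - p.val) % 2 = 0 then ν - p.val - 1 else ν + p.val + 1

theorem posV_lt (ν : ℕ) (a : Fin (ν + 1) ⊕ Fin ν) : posV ν a < 2 * ν + 1 := by
  rcases a with p | p <;> have := p.isLt <;> simp only [posV] <;> split_ifs <;> omega

def posF (ν : ℕ) (a : Fin (ν + 1) ⊕ Fin ν) : Fin (2 * ν + 1) := ⟨posV ν a, posV_lt ν a⟩

theorem posF_inj (ν : ℕ) : Function.Injective (posF ν) := by
  intro a b h
  have h : posV ν a = posV ν b := congrArg Fin.val h
  rcases a with p | p <;> rcases b with q | q <;> have hp := p.isLt <;> have hq := q.isLt <;>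
    simp only [posV] at h
  · congr 1; ext; split_ifs at h <;> omega
  · exfalso; split_ifs at h <;> omega
  · exfalso; split_ifs at h <;> omega
  · congr 1; ext; split_ifs at h <;> omega

noncomputable def mkE (ν : ℕ) (g : Fin (ν + 1) ⊕ Fin ν → Fin (2 * ν + 1))
    (hg : Function.Injective g) : (Fin (ν + 1) ⊕ Fin ν) ≃ Fin (2 * ν + 1) :=
  Equiv.ofBijective g ((Fintype.bijective_iff_injective_and_card g).2 ⟨hg, by simp; omega⟩)

noncomputable def mkT (ν : ℕ) (g : Fin (ν + 1) ⊕ Fin ν → Fin (2 * ν + 1))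
    (hg : Function.Injective g) : Equiv.Perm (Fin (2 * ν + 1)) :=
  (mkE ν (posF ν) (posF_inj ν)).symm.trans (mkE ν g hg)

theorem mkT_pos (ν : ℕ) (g : Fin (ν + 1) ⊕ Fin ν → Fin (2 * ν + 1))
    (hg : Function.Injective g) (a) : mkT ν g hg (posF ν a) = g a := by
  have : (mkE ν (posF ν) (posF_inj ν)).symm (posF ν a) = a := by
    rw [Equiv.symm_apply_eq]; rfl
  simp only [mkT, Equiv.trans_apply, this]; rfl

theorem mkT_symm (ν : ℕ) (g : Fin (ν + 1) ⊕ Fin ν → Fin (2 * ν + 1))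
    (hg : Function.Injective g) (a) : (mkT ν g hg).symm (g a) = posF ν a := by
  rw [Equiv.symm_apply_eq, mkT_pos]

theorem seq_succ {n : ℕ} (σ : Equiv.Perm (Fin n)) (t : Fin n) :
    tourSeq σ t.succ = (σ t).succ := by
  simp [tourSeq, Fin.succ_ne_zero]

theorem seq_zero {n : ℕ} (σ : Equiv.Perm (Fin n)) : tourSeq σ 0 = 0 := by
  simp [tourSeq]

theorem seq_pos (ν : ℕ) (g : Fin (ν + 1) ⊕ Fin ν → Fin (2 * ν + 1))
    (hg : Function.Injective g) (a) (q : Fin (2 * ν + 1 + 1)) (h : q.val = posV ν a + 1) :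
    tourSeq (mkT ν g hg) q = (g a).succ := by
  have : q = (posF ν a).succ := by ext; simp [posF, h]
  rw [this, seq_succ, mkT_pos]

theorem ex_pos (ν : ℕ) (t : ℕ) (ht : t < 2 * ν + 1) : ∃ a, posV ν a = t := by
  obtain ⟨a, ha⟩ := (mkE ν (posF ν) (posF_inj ν)).surjective ⟨t, ht⟩
  exact ⟨a, congrArg Fin.val ha⟩

theorem edges_mkT (ν : ℕ) (g : Fin (ν + 1) ⊕ Fin ν → Fin (2 * ν + 1))
    (hg : Function.Injective g) (e) : e ∈ tourEdges (mkT ν g hg) ↔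
      (∃ a b, posV ν a + 1 = posV ν b ∧ e = s((g a).succ, (g b).succ)) ∨
      (∃ b, posV ν b = 0 ∧ e = s(0, (g b).succ)) ∨
      (∃ a, posV ν a = 2 * ν ∧ e = s((g a).succ, 0)) := by
  constructor
  · rintro ⟨q, rfl⟩
    have hq := q.isLt
    by_cases h0 : q.val = 0
    · obtain ⟨b, hb⟩ := ex_pos ν 0 (by omega)
      have hq0 : q = 0 := Fin.ext h0
      subst hq0
      right; left
      refine ⟨b, hb, ?_⟩
      rw [seq_zero, seq_pos ν g hg b _ (by simp [hb])]
    · obtain ⟨a, ha⟩ := ex_pos ν (q.val - 1) (by omega)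
      by_cases hl : q = Fin.last _
      · have : q.val = 2 * ν + 1 := by rw [hl]; rfl
        right; right
        refine ⟨a, by omega, ?_⟩
        rw [seq_pos ν g hg a q (by omega), hl, Fin.last_add_one, seq_zero]
      · have hv : (q + 1).val = q.val + 1 := by rw [Fin.val_add_one]; simp [hl]
        have hl' : q.val ≠ 2 * ν + 1 := fun h => hl (Fin.ext h)
        obtain ⟨b, hb⟩ := ex_pos ν q.val (by omega)
        left
        refine ⟨a, b, by omega, ?_⟩
        rw [seq_pos ν g hg a q (by omega), seq_pos ν g hg b _ (by omega)]
  · rintro (⟨a, b, h, rfl⟩ | ⟨b, h, rfl⟩ | ⟨a, h, rfl⟩)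
    · have hb := posV_lt ν b
      refine ⟨⟨posV ν b, by omega⟩, ?_⟩
      rw [seq_pos ν g hg a _ (by simp [h]), seq_pos ν g hg b]
      rw [Fin.val_add_one, if_neg]
      intro hh
      have := congrArg Fin.val hh
      simp at this
      omega
    · refine ⟨0, ?_⟩
      rw [seq_zero, seq_pos ν g hg b _ (by simp [h])]
    · refine ⟨Fin.last _, ?_⟩
      rw [seq_pos ν g hg a _ (by simp [h]), Fin.last_add_one, seq_zero]

theorem edges_main (ν : ℕ) (hν : 1 ≤ ν)
    (I : Fin (ν + 1) → Fin (2 * ν + 1)) (J : Fin ν → Fin (2 * ν + 1))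
    (hg : Function.Injective (Sum.elim I J)) :
    tourEdges (mkT ν _ hg) = setA ν I J ∪ setA' ν hν I J := by
  have nI : ∀ (p : Fin (ν + 1)) (h : p.val < ν + 1), I ⟨p.val, h⟩ = I p := fun _ _ => rfl
  ext e
  rw [edges_mkT]
  constructor
  · rintro (⟨a, b, h, rfl⟩ | ⟨b, h, rfl⟩ | ⟨a, h, rfl⟩)
    · rcases a with p | p <;> rcases b with q | q <;> obtain ⟨p, hp⟩ := p <;>
        obtain ⟨q, hq⟩ := q <;> simp only [posV] at h <;> simp only [Sum.elim_inl, Sum.elim_inr]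
      · right; left
        have : (p = 0 ∧ q = 1) ∨ (p = 1 ∧ q = 0) := by split_ifs at h <;> omega
        rcases this with ⟨rfl, rfl⟩ | ⟨rfl, rfl⟩
        · rfl
        · exact Sym2.eq_swap
      · have : p = q ∨ p = q + 2 := by split_ifs at h <;> omega
        rcases this with rfl | rfl
        · left; left; exact ⟨⟨p, hq⟩, rfl⟩
        · right; right; left; exact ⟨⟨q, by omega⟩, rfl⟩
      · have : p = q ∨ q = p + 2 := by split_ifs at h <;> omega
        rcases this with rfl | rfl
        · left; left; exact ⟨⟨p, hp⟩, Sym2.eq_swap⟩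
        · right; right; left; exact ⟨⟨p, by omega⟩, Sym2.eq_swap⟩
      · exfalso; split_ifs at h <;> omega
    · rcases b with ⟨p, hp⟩ | ⟨p, hp⟩ <;> simp only [posV] at h
      · have : p = ν := by split_ifs at h <;> omega
        subst this
        left; right; exact Sym2.eq_swap
      · exfalso; split_ifs at h <;> omega
    · rcases a with ⟨p, hp⟩ | ⟨p, hp⟩ <;> simp only [posV] at h
      · exfalso; split_ifs at h <;> omega
      · have : p = ν - 1 := by split_ifs at h <;> omega
        subst this
        right; right; right; rfl
  · rintro ((⟨⟨p, hp⟩, rfl⟩ | rfl) | (rfl | ⟨⟨q, hq⟩, rfl⟩ | rfl))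
    · left
      by_cases h : (ν - p) % 2 = 0
      · exact ⟨Sum.inr ⟨p, hp⟩, Sum.inl ⟨p, by omega⟩, by simp [posV, h]; omega, Sym2.eq_swap⟩
      · exact ⟨Sum.inl ⟨p, by omega⟩, Sum.inr ⟨p, hp⟩, by simp [posV, h], rfl⟩
    · right; left
      exact ⟨Sum.inl (Fin.last ν), by simp [posV], Sym2.eq_swap⟩
    · left
      by_cases h : ν % 2 = 0
      · exact ⟨Sum.inl ⟨0, by omega⟩, Sum.inl ⟨1, by omega⟩,
          by simp only [posV]; split_ifs <;> omega, rfl⟩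
      · exact ⟨Sum.inl ⟨1, by omega⟩, Sum.inl ⟨0, by omega⟩,
          by simp only [posV]; split_ifs <;> omega, Sym2.eq_swap⟩
    · left
      by_cases h : (ν - q) % 2 = 0
      · exact ⟨Sum.inl ⟨q + 2, by omega⟩, Sum.inr ⟨q, by omega⟩,
          by simp only [posV]; split_ifs <;> omega, rfl⟩
      · exact ⟨Sum.inr ⟨q, by omega⟩, Sum.inl ⟨q + 2, by omega⟩,
          by simp only [posV]; split_ifs <;> omega, Sym2.eq_swap⟩
    · right; right
      exact ⟨Sum.inr ⟨ν - 1, by omega⟩, by simp only [posV]; split_ifs <;> omega, rfl⟩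

theorem seq_rev {n : ℕ} (σ : Equiv.Perm (Fin n)) (q : Fin (n + 1)) :
    tourSeq (revTour σ) q = tourSeq σ (-q) := by
  refine Fin.cases ?_ (fun t => ?_) q
  · simp [seq_zero]
  · have : -t.succ = (Fin.rev t).succ := by
      have := t.isLt
      ext
      rw [Fin.val_neg']
      simp only [Fin.val_succ, Fin.val_rev]
      rw [Nat.mod_eq_of_lt] <;> omega
    rw [this, seq_succ, seq_succ]
    rfl

theorem edges_rev {n : ℕ} (σ : Equiv.Perm (Fin n)) : tourEdges (revTour σ) = tourEdges σ := by
  ext e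
  constructor
  · rintro ⟨q, rfl⟩
    refine ⟨-(q + 1), ?_⟩
    rw [seq_rev, seq_rev, Sym2.eq_swap]
    congr 3
    abel
  · rintro ⟨q, rfl⟩
    refine ⟨-(q + 1), ?_⟩
    rw [seq_rev, seq_rev, Sym2.eq_swap]
    congr 3 <;> abel_nf

def swS (ν : ℕ) (hν : 1 ≤ ν) : Equiv.Perm (Fin (ν + 1) ⊕ Fin ν) :=
  Equiv.swap (Sum.inl ⟨0, by omega⟩) (Sum.inr ⟨0, by omega⟩)

theorem swS_inl (ν : ℕ) (hν : 1 ≤ ν) (p : Fin (ν + 1)) : swS ν hν (Sum.inl p) =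
    if p = ⟨0, by omega⟩ then Sum.inr ⟨0, by omega⟩ else Sum.inl p := by
  by_cases h : p = ⟨0, by omega⟩
  · subst h; simp [swS]
  · rw [if_neg h, swS, Equiv.swap_apply_of_ne_of_ne]
    · exact fun h' => h (Sum.inl.inj h')
    · simp

theorem swS_inr (ν : ℕ) (hν : 1 ≤ ν) (p : Fin ν) : swS ν hν (Sum.inr p) =
    if p = ⟨0, by omega⟩ then Sum.inl ⟨0, by omega⟩ else Sum.inr p := by
  simp [swS, Equiv.swap_apply_def]

theorem elim_sw (ν : ℕ) (hν : 1 ≤ ν)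
    (I : Fin (ν + 1) → Fin (2 * ν + 1)) (J : Fin ν → Fin (2 * ν + 1)) :
    Sum.elim (rowSwap1 ν hν I J) (rowSwap2 ν hν I J) = Sum.elim I J ∘ swS ν hν := by
  funext a
  rcases a with p | p
  · rw [Function.comp_apply, swS_inl]; simp only [Sum.elim_inl, rowSwap1]; split_ifs <;> rfl
  · rw [Function.comp_apply, swS_inr]; simp only [Sum.elim_inr, rowSwap2]; split_ifs <;> rfl

theorem setA_sw (ν : ℕ) (hν : 1 ≤ ν)
    (I : Fin (ν + 1) → Fin (2 * ν + 1)) (J : Fin ν → Fin (2 * ν + 1)) :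
    setA ν (rowSwap1 ν hν I J) (rowSwap2 ν hν I J) = setA ν I J := by
  have h1 : ∀ p : Fin ν, s((rowSwap1 ν hν I J p.castSucc).succ, (rowSwap2 ν hν I J p).succ)
      = s((I p.castSucc).succ, (J p).succ) := by
    rintro ⟨p, hp⟩
    by_cases h : p = 0
    · subst h
      simp only [rowSwap1, rowSwap2, Fin.castSucc_mk, if_true]
      exact Sym2.eq_swap
    · simp [rowSwap1, rowSwap2, h]
  have h2 : rowSwap1 ν hν I J (Fin.last ν) = I (Fin.last ν) := by
    unfold rowSwap1
    rw [if_neg]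
    intro h
    have := congrArg Fin.val h
    simp at this
    omega
  unfold setA
  simp only [h1, h2]

theorem pos_sw_l (ν : ℕ) (hν : 1 ≤ ν) (p q : Fin (ν + 1)) (hpq : p ≠ q) :
    posV ν (Sum.inl p) < posV ν (Sum.inl q) ↔
      posV ν (swS ν hν (Sum.inl p)) < posV ν (swS ν hν (Sum.inl q)) := by
  obtain ⟨p, hp⟩ := p
  obtain ⟨q, hq⟩ := q
  simp only [ne_eq, Fin.mk.injEq] at hpq
  rw [swS_inl, swS_inl]
  simp only [Fin.mk.injEq]
  by_cases h1 : p = 0 <;> by_cases h2 : q = 0 <;> simp only [h1, h2, if_true, if_false, posV] <;>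
    split_ifs <;> omega

theorem pos_sw_r (ν : ℕ) (hν : 1 ≤ ν) (p q : Fin ν) (hpq : p ≠ q) :
    posV ν (Sum.inr p) < posV ν (Sum.inr q) ↔
      posV ν (swS ν hν (Sum.inr p)) < posV ν (swS ν hν (Sum.inr q)) := by
  obtain ⟨p, hp⟩ := p
  obtain ⟨q, hq⟩ := q
  simp only [ne_eq, Fin.mk.injEq] at hpq
  rw [swS_inr, swS_inr]
  simp only [Fin.mk.injEq]
  by_cases h1 : p = 0 <;> by_cases h2 : q = 0 <;> simp only [h1, h2, if_true, if_false, posV] <;>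
    split_ifs <;> omega

/-- with `n = 2ν+1` and rows `(i_1,...,i_{ν+1})`, `(j_1,...,j_ν)`
enumerating `{1,...,n}` without repetition, the edge sets `A ∪ A'` and `A ∪ A''`
(where `A''` is `A'` for the rows with the two position-1 vertices exchanged) are
Hamiltonian cycles on `V`, and with suitable orientations they form a feasible pair of
pickup and delivery tours for the DTSPMS with 2 rows of capacity `ν + 1`. -/
theorem stmt18 (ν : ℕ) (hν : 1 ≤ ν)
    (I : Fin (ν + 1) → Fin (2 * ν + 1)) (J : Fin ν → Fin (2 * ν + 1))
    (hEnum : Function.Injective (Sum.elim I J)) :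
    ∃ TP TD : Equiv.Perm (Fin (2 * ν + 1)),
      tourEdges TP = setA ν I J ∪ setA' ν hν I J ∧
      tourEdges TD = setA ν I J ∪ setA' ν hν (rowSwap1 ν hν I J) (rowSwap2 ν hν I J) ∧
      FeasiblePair 2 (ν + 1) TP TD := by
  have hE2 : Function.Injective (Sum.elim (rowSwap1 ν hν I J) (rowSwap2 ν hν I J)) := by
    rw [elim_sw]; exact hEnum.comp (swS ν hν).injective
  refine ⟨mkT ν _ hEnum, revTour (mkT ν _ hE2), edges_main ν hν I J hEnum, ?_, ?_⟩
  · rw [edges_rev, edges_main ν hν _ _ hE2, setA_sw]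
  · have hsurj := (mkE ν _ hEnum).surjective
    have hs : ∀ a, (mkE ν _ hEnum).symm (Sum.elim I J a) = a := by
      intro a; rw [Equiv.symm_apply_eq]; rfl
    have hT2 : ∀ a, (mkT ν _ hE2).symm (Sum.elim I J a) = posF ν (swS ν hν a) := by
      intro a
      rw [← mkT_symm ν _ hE2]
      have := congrFun (elim_sw ν hν I J) (swS ν hν a)
      rw [this]
      simp [swS]
    have hvis : ∀ x y, visitsBefore (revTour (mkT ν _ hE2)) x y ↔
        (mkT ν _ hE2).symm y < (mkT ν _ hE2).symm x := by
      intro x y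
      simp [visitsBefore, revTour]
    refine ⟨fun x => Sum.elim (fun _ => 0) (fun _ => 1) ((mkE ν _ hEnum).symm x), ?_, ?_⟩
    · intro r
      have key : (Finset.univ.filter fun x : Fin (2 * ν + 1) =>
          Sum.elim (fun _ => (0 : Fin 2)) (fun _ => 1) ((mkE ν _ hEnum).symm x) = r) ⊆
          if r = 0 then Finset.univ.image I else Finset.univ.image J := by
        intro x hx
        obtain ⟨a, rfl⟩ := hsurj x
        rw [Finset.mem_filter, Equiv.symm_apply_apply] at hx
        rcases a with p | p
        · have : r = 0 := hx.2.symm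
          rw [if_pos this]
          exact Finset.mem_image.2 ⟨p, Finset.mem_univ _, rfl⟩
        · have : r = 1 := hx.2.symm
          rw [if_neg (by rw [this]; decide)]
          exact Finset.mem_image.2 ⟨p, Finset.mem_univ _, rfl⟩
      refine (Finset.card_le_card key).trans ?_
      split_ifs
      · exact Finset.card_image_le.trans (by simp)
      · exact Finset.card_image_le.trans (by simp)
    · intro x y hxy hf
      rw [hvis]
      obtain ⟨a, rfl⟩ := hsurj x
      obtain ⟨b, rfl⟩ := hsurj y
      have hab : a ≠ b := fun h => hxy (by rw [h])
      change (mkT ν _ hEnum).symm (Sum.elim I J a) < (mkT ν _ hEnum).symm (Sum.elim I J b) ↔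
        (mkT ν _ hE2).symm (Sum.elim I J a) < (mkT ν _ hE2).symm (Sum.elim I J b)
      rw [mkT_symm, mkT_symm, hT2, hT2]
      simp only [Equiv.symm_apply_apply] at hf
      rcases a with p | p <;> rcases b with q | q
      · exact pos_sw_l ν hν p q (fun h => hab (by rw [h]))
      · simp at hf
      · simp at hf
      · exact pos_sw_r ν hν p q (fun h => hab (by rw [h]))
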